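/- arXiv:2210.07963 — 2 statements merged into one kernel-verified Lean document; each statement's English description precedes it below -/
import Mathlib

section
/- Fano-type single-letter bound for constant-composition codes: Let W be a channel from a finite set 𝒳 to a finite set 𝒴, let n, M ≥ 1, let x₁,…,x_M ∈ 𝒳ⁿ all have the same type P_X, and let h : 𝒴ⁿ → {1,…,M} be any decoder. Suppose that for every w ∈ {1,…,M}, when Y₁,…,Y_n are independent with Y_i ~ W(·|(x_w)_i), the error probability satisfies P( h(Yⁿ) ≠ w ) ≤ ε for some ε ∈ [0,1). Then (1 − ε)·log M − log 2 ≤ n·I(P_X, W). -/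
open scoped BigOperators ENNReal NNReal

namespace JCAS

variable {𝒳 𝒴 𝒵 𝒮 : Type}

/-- `p` is a probability mass function on the finite alphabet `𝒳`. -/
def IsPMF [Fintype 𝒳] (p : 𝒳 → ℝ) : Prop :=
  (∀ x, 0 ≤ p x) ∧ ∑ x, p x = 1

/-- `V` is a channel (conditional probability distribution) from `𝒳` to `𝒴`. -/
def IsChannel [Fintype 𝒳] [Fintype 𝒴] (V : 𝒳 → 𝒴 → ℝ) : Prop :=
  ∀ x, IsPMF (V x)

/-- Mutual information `I(P, V)` (natural logarithm), with `0·log(0/a) = 0`. -/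
noncomputable def mutualInfo [Fintype 𝒳] [Fintype 𝒴] (P : 𝒳 → ℝ) (V : 𝒳 → 𝒴 → ℝ) : ℝ :=
  ∑ x, ∑ y, P x * V x y * Real.log (V x y / ∑ x', P x' * V x' y)

/-- `a ^ ℓ` with the convention `0 ^ ℓ = 0` (in particular `0 ^ 0 = 0`). -/
noncomputable def pow0 (a ℓ : ℝ) : ℝ := if a = 0 then 0 else a ^ ℓ

/-- `Σ_z W(z)^ℓ · W'(z)^{1-ℓ}`. -/
noncomputable def chernoffSum [Fintype 𝒵] (W W' : 𝒵 → ℝ) (ℓ : ℝ) : ℝ :=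
  ∑ z, pow0 (W z) ℓ * pow0 (W' z) (1 - ℓ)

/-- Chernoff information between the channels `W` and `W'` under input distribution `P`:
`max_{ℓ∈[0,1]} −Σ_x P(x) log( Σ_z W(z|x)^ℓ W'(z|x)^{1−ℓ} )`. -/
noncomputable def chernoffPair [Fintype 𝒳] [Fintype 𝒵] (P : 𝒳 → ℝ) (W W' : 𝒳 → 𝒵 → ℝ) : ℝ :=
  sSup ((fun ℓ => -∑ x, P x * Real.log (chernoffSum (W x) (W' x) ℓ)) '' Set.Icc (0 : ℝ) 1)

/-- `ψ_s(P) = min_{s' ≠ s} (Chernoff information between `W_s` and `W_{s'}` under `P`)`. -/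
noncomputable def psi [Fintype 𝒳] [Fintype 𝒵] (WZ : 𝒮 → 𝒳 → 𝒵 → ℝ) (P : 𝒳 → ℝ) (s : 𝒮) : ℝ :=
  sInf ((fun s' => chernoffPair P (WZ s) (WZ s')) '' {s' : 𝒮 | s' ≠ s})

/-- Chernoff detection-error exponent `φ(P) = min_s ψ_s(P)`. -/
noncomputable def phi [Fintype 𝒳] [Fintype 𝒵] (WZ : 𝒮 → 𝒳 → 𝒵 → ℝ) (P : 𝒳 → ℝ) : ℝ :=
  ⨅ s, psi WZ P s

/-- Standing assumption: for all `s ≠ s'` the best Chernoff information is positive. -/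
def StandingAssumption [Fintype 𝒳] [Fintype 𝒵] (WZ : 𝒮 → 𝒳 → 𝒵 → ℝ) : Prop :=
  ∀ s s' : 𝒮, s ≠ s' →
    0 < sSup ((fun P => chernoffPair P (WZ s) (WZ s')) '' {P : 𝒳 → ℝ | IsPMF P})

/-- Empirical distribution (type) of a sequence `x ∈ 𝒳ⁿ`. -/
noncomputable def empDist [Fintype 𝒳] [DecidableEq 𝒳] {n : ℕ} (x : Fin n → 𝒳) (a : 𝒳) : ℝ :=
  (Finset.univ.filter (fun i => x i = a)).card / n

/-- Pointwise form of the Donsker–Varadhan inequality. -/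
theorem mul_log_add_sub_le_mul_log_div {p q c : ℝ} (hp : 0 ≤ p) (hq : 0 ≤ q)
    (hpq : q = 0 → p = 0) (hc : 0 < c) :
    p * Real.log c + p - c * q ≤ p * Real.log (p / q) := by
  rcases hp.eq_or_lt with rfl | hp
  · simpa using mul_nonneg hc.le hq
  have hq' : 0 < q := hq.lt_of_ne fun h0 => hp.ne' (hpq h0.symm)
  have hlog := Real.log_le_sub_one_of_pos (show 0 < c * q / p by positivity)
  rw [Real.log_div (by positivity) hp.ne', Real.log_mul hc.ne' hq'.ne'] at hlog
  rw [Real.log_div hp.ne' hq'.ne']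
  have hmul := mul_le_mul_of_nonneg_left hlog hp.le
  have hcancel : p * (c * q / p - 1) = c * q - p := by field_simp
  linarith

/-- A product of probability mass functions has total mass one. -/
theorem sum_prod_eq_one [Fintype 𝒴] {n : ℕ} {p : Fin n → 𝒴 → ℝ} (hp : ∀ i, IsPMF (p i)) :
    ∑ y : Fin n → 𝒴, ∏ i, p i (y i) = 1 := by
  rw [← Fintype.prod_sum]
  exact Finset.prod_eq_one fun i _ => (hp i).2

/-- Expectation of an additive functional under a product of probability mass functions. -/
theorem sum_prod_mul_sum [Fintype 𝒴] {n : ℕ} {p : Fin n → 𝒴 → ℝ} (hp : ∀ i, IsPMF (p i))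
    (g : Fin n → 𝒴 → ℝ) :
    ∑ y : Fin n → 𝒴, (∏ i, p i (y i)) * ∑ i, g i (y i) = ∑ i, ∑ b, p i b * g i b := by
  simp_rw [Finset.mul_sum]
  rw [Finset.sum_comm]
  refine Finset.sum_congr rfl fun i _ => ?_
  have hprod : ∀ y : Fin n → 𝒴, (∏ j, p j (y j)) * g i (y i) =
      ∏ j, p j (y j) * (if j = i then g i (y j) else 1) := fun y => by
    rw [Finset.prod_mul_distrib, Finset.prod_ite_eq' Finset.univ i]
    simp
  simp_rw [hprod]
  rw [← Fintype.prod_sum fun j b => p j b * (if j = i then g i b else 1)]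
  rw [Finset.prod_eq_single i]
  · simp
  · intro j _ hj
    simpa [hj] using (hp j).2
  · simp

/-- Averaging over the positions of a sequence is averaging with respect to its type. -/
theorem sum_comp_eq_mul_sum_empDist [Fintype 𝒳] [DecidableEq 𝒳] {n : ℕ} (hn : 0 < n)
    (x : Fin n → 𝒳) (f : 𝒳 → ℝ) :
    ∑ i, f (x i) = n * ∑ a, empDist x a * f a := by
  have hn' : (n : ℝ) ≠ 0 := by positivity
  rw [← Finset.sum_fiberwise Finset.univ x, Finset.mul_sum]
  refine Finset.sum_congr rfl fun a _ => ?_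
  rw [Finset.sum_congr rfl fun i hi => by rw [(Finset.mem_filter.mp hi).2],
    Finset.sum_const, nsmul_eq_mul, empDist]
  field_simp

theorem isPMF_empDist [Fintype 𝒳] [DecidableEq 𝒳] {n : ℕ} (hn : 0 < n) (x : Fin n → 𝒳) :
    IsPMF (empDist x) := by
  refine ⟨fun a => by unfold empDist; positivity, ?_⟩
  have hsum := sum_comp_eq_mul_sum_empDist hn x fun _ => 1
  have hn' : (n : ℝ) ≠ 0 := by positivity
  simpa [hn'] using hsum

theorem empDist_pos [Fintype 𝒳] [DecidableEq 𝒳] {n : ℕ} (x : Fin n → 𝒳) (i : Fin n) :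
    0 < empDist x (x i) := by
  have hn : 0 < n := i.pos
  have hcard : 0 < (Finset.univ.filter fun j => x j = x i).card :=
    Finset.card_pos.mpr ⟨i, by simp⟩
  unfold empDist
  positivity

/-- The output distribution of a channel is a probability mass function. -/
theorem isPMF_output [Fintype 𝒳] [Fintype 𝒴] {P : 𝒳 → ℝ} {W : 𝒳 → 𝒴 → ℝ} (hP : IsPMF P)
    (hW : IsChannel W) : IsPMF fun b => ∑ a, P a * W a b := by
  refine ⟨fun b => Finset.sum_nonneg fun a _ => mul_nonneg (hP.1 a) ((hW a).1 b), ?_⟩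
  rw [Finset.sum_comm]
  simp_rw [← Finset.mul_sum, (hW _).2, mul_one]
  exact hP.2

/-- For an input of type `P`, the divergence of the output law from the product of the
single-letter output distributions is `n * I(P, W)`. -/
theorem sum_prod_mul_log_div_eq [Fintype 𝒳] [Fintype 𝒴] [DecidableEq 𝒳] {W : 𝒳 → 𝒴 → ℝ}
    (hW : IsChannel W) {n : ℕ} (hn : 0 < n) (x : Fin n → 𝒳) {q : 𝒴 → ℝ}
    (hq : ∀ b, q b = ∑ a, empDist x a * W a b) (hWq : ∀ i b, q b = 0 → W (x i) b = 0) :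
    ∑ y : Fin n → 𝒴, (∏ i, W (x i) (y i)) *
      Real.log ((∏ i, W (x i) (y i)) / ∏ i, q (y i)) = n * mutualInfo (empDist x) W := by
  have hlog : ∀ y : Fin n → 𝒴, (∏ i, W (x i) (y i)) *
      Real.log ((∏ i, W (x i) (y i)) / ∏ i, q (y i)) =
      (∏ i, W (x i) (y i)) * ∑ i, Real.log (W (x i) (y i) / q (y i)) := fun y => by
    by_cases h0 : ∏ i, W (x i) (y i) = 0
    · simp [h0]
    have hW0 := fun i => Finset.prod_ne_zero_iff.mp h0 i (Finset.mem_univ i)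
    rw [← Finset.prod_div_distrib, Real.log_prod]
    exact fun i _ => div_ne_zero (hW0 i) fun hq0 => hW0 i (hWq i _ hq0)
  simp_rw [hlog]
  rw [sum_prod_mul_sum (fun i => hW (x i)) fun i b => Real.log (W (x i) b / q b),
    sum_comp_eq_mul_sum_empDist hn x fun a => ∑ b, W a b * Real.log (W a b / q b)]
  simp_rw [mutualInfo, hq, Finset.mul_sum, mul_assoc]

/-- Fano-type single-letter bound for constant-composition codes. -/
theorem fano_constant_composition
    [Fintype 𝒳] [Fintype 𝒴] [DecidableEq 𝒳]
    (W : 𝒳 → 𝒴 → ℝ) (hW : IsChannel W)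
    (n M : ℕ) (hn : 0 < n) (hM : 1 ≤ M)
    (x : Fin M → Fin n → 𝒳) (P : 𝒳 → ℝ)
    (htype : ∀ (w : Fin M) (a : 𝒳), empDist (x w) a = P a)
    (h : (Fin n → 𝒴) → Fin M)
    (ε : ℝ) (hε0 : 0 ≤ ε) (hε1 : ε < 1)
    (herr : ∀ w : Fin M,
      (∑ y : Fin n → 𝒴, if h y ≠ w then ∏ i, W (x w i) (y i) else 0) ≤ ε) :
    (1 - ε) * Real.log M - Real.log 2 ≤ (n : ℝ) * mutualInfo P W := by
  classical
  obtain ⟨M0⟩ : Nonempty (Fin M) := ⟨⟨0, hM⟩⟩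
  have hMpos : (0 : ℝ) < M := by exact_mod_cast hM
  have hP : ∀ w, empDist (x w) = P := fun w => funext (htype w)
  set q : 𝒴 → ℝ := fun b => ∑ a, P a * W a b with hq
  have hPpmf : IsPMF P := hP M0 ▸ isPMF_empDist hn (x M0)
  have hqpmf : IsPMF q := isPMF_output hPpmf hW
  have hQ0 : ∀ y : Fin n → 𝒴, 0 ≤ ∏ i, q (y i) :=
    fun y => Finset.prod_nonneg fun i _ => hqpmf.1 _
  have hQ1 : ∑ y : Fin n → 𝒴, ∏ i, q (y i) = 1 := sum_prod_eq_one fun _ => hqpmf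
  have hWq : ∀ w i b, q b = 0 → W (x w i) b = 0 := fun w i b h0 => by
    have hterm := (Finset.sum_eq_zero_iff_of_nonneg
      fun a _ => mul_nonneg (hPpmf.1 a) ((hW a).1 b)).mp h0 (x w i) (Finset.mem_univ _)
    have hpos : 0 < P (x w i) := hP w ▸ empDist_pos (x w) i
    exact (mul_eq_zero.mp hterm).resolve_left hpos.ne'
  obtain ⟨w, -, hw⟩ : ∃ w ∈ (Finset.univ : Finset (Fin M)),
      (∑ y : Fin n → 𝒴, if h y = w then ∏ i, q (y i) else 0) ≤ 1 / (M : ℝ) := by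
    refine Finset.exists_le_of_sum_le ⟨M0, Finset.mem_univ _⟩ ?_
    rw [Finset.sum_comm]
    simp [hQ1, hMpos.ne']
  set p : (Fin n → 𝒴) → ℝ := fun y => ∏ i, W (x w i) (y i) with hp
  have hp1 : ∑ y, p y = 1 := sum_prod_eq_one fun i => hW (x w i)
  have hcorrect : 1 - ε ≤ ∑ y, if h y = w then p y else 0 := by
    have hsplit : (∑ y, if h y = w then p y else 0) + (∑ y, if h y ≠ w then p y else 0) = 1 := by
      rw [← Finset.sum_add_distrib, ← hp1]
      refine Finset.sum_congr rfl fun y _ => ?_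
      by_cases hy : h y = w <;> simp [hy]
    linarith [herr w]
  have hdiv := sum_prod_mul_log_div_eq hW hn (x w) (q := q) (by simp [hq, hP]) (hWq w)
  rw [hP] at hdiv
  -- the Donsker–Varadhan test function is `log M` on the decoding region of `w` and `0` elsewhere
  have hpoint : ∀ y, ((if h y = w then p y else 0) * Real.log M - p y * Real.log 2 + p y
      - (M * (if h y = w then ∏ i, q (y i) else 0) + ∏ i, q (y i)) / 2) ≤
      p y * Real.log (p y / ∏ i, q (y i)) := fun y => by
    have hp0 : 0 ≤ p y := Finset.prod_nonneg fun i _ => (hW _).1 _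
    have hpq : ∏ i, q (y i) = 0 → p y = 0 := fun h0 => by
      obtain ⟨i, hi, hqi⟩ := Finset.prod_eq_zero_iff.mp h0
      exact Finset.prod_eq_zero hi (hWq w i _ hqi)
    by_cases hy : h y = w
    · have hdv := mul_log_add_sub_le_mul_log_div hp0 (hQ0 y) hpq
        (show (0 : ℝ) < (M + 1) / 2 by positivity)
      have hlogM : Real.log M - Real.log 2 ≤ Real.log ((M + 1) / 2) := by
        rw [← Real.log_div hMpos.ne' two_ne_zero]
        exact Real.log_le_log (by positivity) (by linarith)
      simp only [hy, if_true]
      nlinarith [mul_le_mul_of_nonneg_left hlogM hp0]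
    · have hdv := mul_log_add_sub_le_mul_log_div hp0 (hQ0 y) hpq
        (show (0 : ℝ) < 2⁻¹ by positivity)
      rw [Real.log_inv] at hdv
      simp only [hy, if_false]
      linarith
  have hsum := Finset.sum_le_sum fun y (_ : y ∈ Finset.univ) => hpoint y
  rw [hdiv, Finset.sum_sub_distrib, Finset.sum_add_distrib, Finset.sum_sub_distrib,
    ← Finset.sum_mul, ← Finset.sum_mul, ← Finset.sum_div, Finset.sum_add_distrib,
    ← Finset.mul_sum, hp1, hQ1] at hsum
  have hMq := mul_le_mul_of_nonneg_left hw hMpos.le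
  rw [mul_one_div_cancel hMpos.ne'] at hMq
  have hlogM0 : 0 ≤ Real.log M := Real.log_nonneg (by exact_mod_cast hM)
  have hmain := mul_le_mul_of_nonneg_right hcorrect hlogM0
  linarith

end JCAS
end

section
/- Positivity and vanishing of the successive exponent: Fix a probability distribution P_X on 𝒳. (i) If R ≥ min_{s∈𝒮} I(P_X, W_{Y|X,s}), then ρ_succ(P_X,R) = 0. (ii) If 0 ≤ R < min_{s∈𝒮} I(P_X, W_{Y|X,s}), then ρ_succ(P_X,R) > 0. -/
open scoped BigOperators ENNReal NNReal

namespace JCAS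

variable {𝒳 𝒴 𝒵 𝒮 : Type}

/-- Conditional entropy `H(Q | P)` (natural logarithm). -/
noncomputable def condH [Fintype 𝒳] [Fintype 𝒴] (P : 𝒳 → ℝ) (Q : 𝒳 → 𝒴 → ℝ) : ℝ :=
  -∑ x, ∑ y, P x * Q x y * Real.log (Q x y)

/-- Output distribution `(P ∘ Q)(y) = Σ_x P(x) Q(y|x)`. -/
noncomputable def outDist [Fintype 𝒳] (P : 𝒳 → ℝ) (Q : 𝒳 → 𝒴 → ℝ) (y : 𝒴) : ℝ :=
  ∑ x, P x * Q x y

/-- Shannon entropy of a distribution on `𝒴` (natural logarithm). -/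
noncomputable def ent [Fintype 𝒴] (Q : 𝒴 → ℝ) : ℝ := -∑ y, Q y * Real.log (Q y)

open Classical in
/-- Conditional relative entropy `D(Q ‖ V | P)`, equal to `+∞` when absolute continuity
fails. -/
noncomputable def condKL [Fintype 𝒳] [Fintype 𝒴] (P : 𝒳 → ℝ) (Q V : 𝒳 → 𝒴 → ℝ) : ℝ≥0∞ :=
  if ∀ x y, P x * Q x y ≠ 0 → V x y ≠ 0 then
    ENNReal.ofReal (∑ x, ∑ y, P x * Q x y * Real.log (Q x y / V x y))
  else ⊤

/-- Successive-scheme exponent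
`ρ_succ(P,R) = min_s inf_{Q} [ D(Q‖W_s|P) + |I(P,Q) − R|⁺ ]`, in `ℝ≥0∞`. -/
noncomputable def rhoSucc [Fintype 𝒳] [Fintype 𝒴] (W : 𝒮 → 𝒳 → 𝒴 → ℝ)
    (P : 𝒳 → ℝ) (R : ℝ) : ℝ≥0∞ :=
  ⨅ s, ⨅ Q ∈ {Q : 𝒳 → 𝒴 → ℝ | IsChannel Q},
    condKL P Q (W s) + ENNReal.ofReal (mutualInfo P Q - R)

/-- `β(Q,P,R,s)`: infimum of `D(Q''‖W_s|P) + H(Q''|P)` over channels `Q''` with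
`I(P,Q'') < R` and `P∘Q'' = P∘Q` (`+∞` if no such channel exists). -/
noncomputable def beta [Fintype 𝒳] [Fintype 𝒴] (W : 𝒮 → 𝒳 → 𝒴 → ℝ) (Q : 𝒳 → 𝒴 → ℝ)
    (P : 𝒳 → ℝ) (R : ℝ) (s : 𝒮) : ℝ≥0∞ :=
  ⨅ Q'' ∈ {Q'' : 𝒳 → 𝒴 → ℝ | IsChannel Q'' ∧ mutualInfo P Q'' < R ∧
      ∀ y, outDist P Q'' y = outDist P Q y},
    condKL P Q'' (W s) + ENNReal.ofReal (condH P Q'')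

/-- The set `P_{s,s'}(Q,P,R)` of conditional distributions. -/
def PSet [Fintype 𝒳] [Fintype 𝒴] (W : 𝒮 → 𝒳 → 𝒴 → ℝ) (Q : 𝒳 → 𝒴 → ℝ)
    (P : 𝒳 → ℝ) (R : ℝ) (s s' : 𝒮) : Set (𝒳 → 𝒴 → ℝ) :=
  {Q' | IsChannel Q' ∧
    condKL P Q' (W s') + ENNReal.ofReal (condH P Q')
      ≤ min (beta W Q P R s) (condKL P Q (W s) + ENNReal.ofReal (condH P Q)) ∧
    ∀ y, outDist P Q' y = outDist P Q y}

/-- Joint decoding-and-detection exponent `ρ_joint(P,R)`, in `ℝ≥0∞`; truncated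
subtraction implements `|·−R|⁺` and an infimum over an empty set is `+∞`. -/
noncomputable def rhoJoint [Fintype 𝒳] [Fintype 𝒴] (W : 𝒮 → 𝒳 → 𝒴 → ℝ)
    (P : 𝒳 → ℝ) (R : ℝ) : ℝ≥0∞ :=
  ⨅ s, ⨅ Q ∈ {Q : 𝒳 → 𝒴 → ℝ | IsChannel Q},
    condKL P Q (W s) +
      ((⨅ s' ∈ {s' : 𝒮 | s' ≠ s}, ⨅ Q' ∈ PSet W Q P R s s',
          ENNReal.ofReal (mutualInfo P Q')) - ENNReal.ofReal R)

/-- `γ₁(Q,R,s) = D(Q‖W_s|P) + |I(P,Q) − R|⁺`. -/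
noncomputable def gamma1 [Fintype 𝒳] [Fintype 𝒴] (W : 𝒮 → 𝒳 → 𝒴 → ℝ) (P : 𝒳 → ℝ)
    (Q : 𝒳 → 𝒴 → ℝ) (R : ℝ) (s : 𝒮) : ℝ≥0∞ :=
  condKL P Q (W s) + ENNReal.ofReal (mutualInfo P Q - R)

/-- `γ₂(Q,R,s) = D(Q‖W_s|P) + | D(Q‖W_s|P) + H(P∘Q) − β(Q,P,R,s) − R |⁺`. -/
noncomputable def gamma2 [Fintype 𝒳] [Fintype 𝒴] (W : 𝒮 → 𝒳 → 𝒴 → ℝ) (P : 𝒳 → ℝ)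
    (Q : 𝒳 → 𝒴 → ℝ) (R : ℝ) (s : 𝒮) : ℝ≥0∞ :=
  condKL P Q (W s) +
    ((condKL P Q (W s) + ENNReal.ofReal (ent (outDist P Q)) - beta W Q P R s)
      - ENNReal.ofReal R)

/-- `P'_{Y|X}(P,R,s)`: channels `Q` with `max_{s''} β(Q,P,R,s'') ≥ D(Q‖W_s|P) + H(Q|P)`. -/
def PsetPrime [Fintype 𝒳] [Fintype 𝒴] [Fintype 𝒮] (W : 𝒮 → 𝒳 → 𝒴 → ℝ) (P : 𝒳 → ℝ)
    (R : ℝ) (s : 𝒮) : Set (𝒳 → 𝒴 → ℝ) :=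
  {Q | IsChannel Q ∧
    condKL P Q (W s) + ENNReal.ofReal (condH P Q) ≤ ⨆ s'', beta W Q P R s''}

/-- `P''_{Y|X}(P,R,s)`: channels `Q` with `max_{s''} β(Q,P,R,s'') < D(Q‖W_s|P) + H(Q|P)`. -/
def PsetDoublePrime [Fintype 𝒳] [Fintype 𝒴] [Fintype 𝒮] (W : 𝒮 → 𝒳 → 𝒴 → ℝ) (P : 𝒳 → ℝ)
    (R : ℝ) (s : 𝒮) : Set (𝒳 → 𝒴 → ℝ) :=
  {Q | IsChannel Q ∧
    (⨆ s'', beta W Q P R s'') < condKL P Q (W s) + ENNReal.ofReal (condH P Q)}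

lemma isCompact_setOf_isChannel [Fintype 𝒳] [Fintype 𝒴] :
    IsCompact {Q : 𝒳 → 𝒴 → ℝ | IsChannel Q} := by
  have h : {Q : 𝒳 → 𝒴 → ℝ | IsChannel Q} = Set.univ.pi fun _ => stdSimplex ℝ 𝒴 := by
    ext Q
    simp [IsChannel, IsPMF, stdSimplex]
  rw [h]
  exact isCompact_univ_pi fun _ => isCompact_stdSimplex ℝ 𝒴

/-- Mutual information as output entropy minus conditional entropy. -/
lemma mutualInfo_eq_ent_sub_condH [Fintype 𝒳] [Fintype 𝒴] {P : 𝒳 → ℝ} {V : 𝒳 → 𝒴 → ℝ}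
    (hP : ∀ x, 0 ≤ P x) (hV : ∀ x y, 0 ≤ V x y) :
    mutualInfo P V = ent (outDist P V) - condH P V := by
  have hterm : ∀ x y, P x * V x y * Real.log (V x y / ∑ x', P x' * V x' y) =
      P x * V x y * Real.log (V x y) - P x * V x y * Real.log (outDist P V y) := by
    intro x y
    rcases eq_or_ne (P x * V x y) 0 with h | h
    · simp [h]
    · have hpos : 0 < P x * V x y := lt_of_le_of_ne (mul_nonneg (hP x) (hV x y)) h.symm
      have hout : 0 < outDist P V y := hpos.trans_le <|
        Finset.single_le_sum (f := fun x' => P x' * V x' y)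
          (fun x' _ => mul_nonneg (hP x') (hV x' y)) (Finset.mem_univ x)
      rw [← mul_sub, ← Real.log_div (right_ne_zero_of_mul h) hout.ne', outDist]
  simp only [mutualInfo, hterm, Finset.sum_sub_distrib, ent, condH]
  rw [Finset.sum_comm (f := fun x y => P x * V x y * Real.log (outDist P V y))]
  simp only [← Finset.sum_mul, outDist]
  ring

lemma continuousOn_mutualInfo [Fintype 𝒳] [Fintype 𝒴] {P : 𝒳 → ℝ} (hP : ∀ x, 0 ≤ P x) :
    ContinuousOn (mutualInfo P) {Q : 𝒳 → 𝒴 → ℝ | IsChannel Q} := by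
  have hc : Continuous fun Q : 𝒳 → 𝒴 → ℝ => ent (outDist P Q) - condH P Q := by
    unfold ent condH outDist
    simp only [mul_assoc]
    refine .sub (.neg <| continuous_finsetSum _ fun y _ =>
      Real.continuous_mul_log.comp (by fun_prop)) (.neg <| continuous_finsetSum _ fun x _ =>
      continuous_finsetSum _ fun y _ => continuous_const.mul <|
      Real.continuous_mul_log.comp (by fun_prop))
  exact hc.continuousOn.congr fun Q hQ =>
    mutualInfo_eq_ent_sub_condH hP fun x y => (hQ x).1 y

/-- Mutual information depends on the channel only through inputs of nonzero probability. -/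
lemma mutualInfo_congr [Fintype 𝒳] [Fintype 𝒴] {P : 𝒳 → ℝ} {Q V : 𝒳 → 𝒴 → ℝ}
    (h : ∀ x y, P x = 0 ∨ Q x y = V x y) : mutualInfo P Q = mutualInfo P V := by
  have hmul : ∀ x y, P x * Q x y = P x * V x y := fun x y => by
    rcases h x y with h | h <;> simp [h]
  unfold mutualInfo
  simp only [hmul]
  refine Finset.sum_congr rfl fun x _ => Finset.sum_congr rfl fun y _ => ?_
  rcases h x y with h | h <;> simp [h]

/-- Averaged squared Hellinger distance between the channels `Q` and `V` under input `P`. -/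
noncomputable def hellingerSq [Fintype 𝒳] [Fintype 𝒴] (P : 𝒳 → ℝ) (Q V : 𝒳 → 𝒴 → ℝ) : ℝ :=
  ∑ x, ∑ y, P x * (√(Q x y) - √(V x y)) ^ 2

lemma hellingerSq_nonneg [Fintype 𝒳] [Fintype 𝒴] {P : 𝒳 → ℝ} (hP : ∀ x, 0 ≤ P x)
    (Q V : 𝒳 → 𝒴 → ℝ) : 0 ≤ hellingerSq P Q V :=
  Finset.sum_nonneg fun x _ => Finset.sum_nonneg fun _ _ => mul_nonneg (hP x) (sq_nonneg _)

lemma eq_of_hellingerSq_eq_zero [Fintype 𝒳] [Fintype 𝒴] {P : 𝒳 → ℝ} {Q V : 𝒳 → 𝒴 → ℝ}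
    (hP : ∀ x, 0 ≤ P x) (hQ : ∀ x y, 0 ≤ Q x y) (hV : ∀ x y, 0 ≤ V x y)
    (h : hellingerSq P Q V = 0) (x : 𝒳) (y : 𝒴) : P x = 0 ∨ Q x y = V x y := by
  have hnn : ∀ x y, 0 ≤ P x * (√(Q x y) - √(V x y)) ^ 2 :=
    fun x y => mul_nonneg (hP x) (sq_nonneg _)
  have hx := (Finset.sum_eq_zero_iff_of_nonneg
    fun x _ => Finset.sum_nonneg fun y _ => hnn x y).1 h x (Finset.mem_univ x)
  have hxy := (Finset.sum_eq_zero_iff_of_nonneg fun y _ => hnn x y).1 hx y (Finset.mem_univ y)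
  refine (mul_eq_zero.1 hxy).imp_right fun h => ?_
  exact (Real.sqrt_inj (hQ x y) (hV x y)).1 (sub_eq_zero.1 (pow_eq_zero_iff two_ne_zero |>.1 h))

lemma sq_sqrt_sub_sqrt_le_mul_log {t v : ℝ} (ht : 0 ≤ t) (hv : 0 ≤ v) (h : t ≠ 0 → v ≠ 0) :
    (√t - √v) ^ 2 + (t - v) ≤ t * Real.log (t / v) := by
  rcases ht.eq_or_lt with rfl | ht
  · simp [hv]
  have hv : 0 < v := lt_of_le_of_ne hv (h ht.ne').symm
  have hst := Real.sqrt_pos.2 ht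
  have hlog : Real.log (√v / √t) = -Real.log (t / v) / 2 := by
    rw [← Real.sqrt_div hv.le, Real.log_sqrt (by positivity), ← inv_div t v, Real.log_inv]
  have hle := Real.log_le_sub_one_of_pos (div_pos (Real.sqrt_pos.2 hv) hst)
  rw [hlog] at hle
  have hmul : t * (√v / √t) = √t * √v := by
    nth_rewrite 1 [← Real.mul_self_sqrt ht.le]
    field_simp
  have := mul_le_mul_of_nonneg_left hle ht.le
  nlinarith [Real.sq_sqrt ht.le, Real.sq_sqrt hv.le]

lemma ofReal_hellingerSq_le_condKL [Fintype 𝒳] [Fintype 𝒴] {P : 𝒳 → ℝ} {Q V : 𝒳 → 𝒴 → ℝ}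
    (hP : ∀ x, 0 ≤ P x) (hQ : IsChannel Q) (hV : IsChannel V) :
    ENNReal.ofReal (hellingerSq P Q V) ≤ condKL P Q V := by
  unfold condKL
  split_ifs with hac
  · refine ENNReal.ofReal_le_ofReal (Finset.sum_le_sum fun x _ => ?_)
    rcases (hP x).eq_or_lt with hx | hx
    · simp [← hx]
    have hle : ∑ y, ((√(Q x y) - √(V x y)) ^ 2 + (Q x y - V x y)) ≤
        ∑ y, Q x y * Real.log (Q x y / V x y) :=
      Finset.sum_le_sum fun y _ => sq_sqrt_sub_sqrt_le_mul_log ((hQ x).1 y) ((hV x).1 y)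
        fun h => hac x y (mul_ne_zero hx.ne' h)
    rw [Finset.sum_add_distrib, Finset.sum_sub_distrib, (hQ x).2, (hV x).2, sub_self,
      add_zero] at hle
    simp only [mul_assoc, ← Finset.mul_sum]
    exact mul_le_mul_of_nonneg_left hle hx.le
  · exact le_top

lemma condKL_self [Fintype 𝒳] [Fintype 𝒴] (P : 𝒳 → ℝ) (V : 𝒳 → 𝒴 → ℝ) : condKL P V V = 0 := by
  simp [condKL]

/-- A single-state exponent is positive strictly below the mutual information. -/
lemma iInf_condKL_add_pos [Fintype 𝒳] [Fintype 𝒴] {P : 𝒳 → ℝ} {V : 𝒳 → 𝒴 → ℝ} {R : ℝ}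
    (hP : ∀ x, 0 ≤ P x) (hV : IsChannel V) (hR : R < mutualInfo P V) :
    0 < ⨅ Q ∈ {Q : 𝒳 → 𝒴 → ℝ | IsChannel Q},
      condKL P Q V + ENNReal.ofReal (mutualInfo P Q - R) := by
  have hcont : ContinuousOn (fun Q => hellingerSq P Q V + max (mutualInfo P Q - R) 0)
      {Q : 𝒳 → 𝒴 → ℝ | IsChannel Q} := by
    refine .add ?_ (.sup (.sub (continuousOn_mutualInfo hP) continuousOn_const) continuousOn_const)
    unfold hellingerSq
    fun_prop
  obtain ⟨Q₀, hQ₀, hmin⟩ := isCompact_setOf_isChannel.exists_isMinOn ⟨V, hV⟩ hcont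
  have hpos : 0 < hellingerSq P Q₀ V + max (mutualInfo P Q₀ - R) 0 := by
    rcases (hellingerSq_nonneg hP Q₀ V).eq_or_lt with h | h
    · rw [← mutualInfo_congr (eq_of_hellingerSq_eq_zero hP (fun x => (hQ₀ x).1)
        (fun x => (hV x).1) h.symm)] at hR
      rw [← h, zero_add]
      exact lt_max_of_lt_left (sub_pos.2 hR)
    · exact add_pos_of_pos_of_nonneg h (le_max_right _ _)
  refine (ENNReal.ofReal_pos.2 hpos).trans_le (le_iInf₂ fun Q hQ => ?_)
  calc ENNReal.ofReal (hellingerSq P Q₀ V + max (mutualInfo P Q₀ - R) 0)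
      ≤ ENNReal.ofReal (hellingerSq P Q V + max (mutualInfo P Q - R) 0) :=
        ENNReal.ofReal_le_ofReal (hmin hQ)
    _ ≤ ENNReal.ofReal (hellingerSq P Q V) + ENNReal.ofReal (max (mutualInfo P Q - R) 0) :=
        ENNReal.ofReal_add_le
    _ ≤ condKL P Q V + ENNReal.ofReal (mutualInfo P Q - R) := by
        rw [ENNReal.ofReal_max, ENNReal.ofReal_zero, max_eq_left zero_le]
        gcongr
        exact ofReal_hellingerSq_le_condKL hP hQ hV

/-- the successive exponent vanishes at and above the compound mutual
information, and is positive strictly below it. -/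
theorem rhoSucc_positivity_vanishing
    [Fintype 𝒳] [Fintype 𝒴] [Fintype 𝒮] [Nonempty 𝒮]
    (W : 𝒮 → 𝒳 → 𝒴 → ℝ) (hW : ∀ s, IsChannel (W s))
    (P : 𝒳 → ℝ) (hP : IsPMF P) :
    (∀ R : ℝ, (⨅ s, mutualInfo P (W s)) ≤ R → rhoSucc W P R = 0) ∧
    (∀ R : ℝ, 0 ≤ R → R < (⨅ s, mutualInfo P (W s)) → 0 < rhoSucc W P R) := by
  refine ⟨fun R hR => ?_, fun R _ hR => ?_⟩
  · obtain ⟨s, hs⟩ := exists_eq_ciInf_of_finite (f := fun s => mutualInfo P (W s))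
    refine le_antisymm ((iInf_le_of_le s (iInf₂_le (W s) (hW s))).trans ?_) zero_le
    rw [condKL_self, zero_add, ENNReal.ofReal_eq_zero.2 (sub_nonpos.2 (hs.trans_le hR))]
  · obtain ⟨s, hs⟩ := exists_eq_ciInf_of_finite (f := fun s =>
      ⨅ Q ∈ {Q : 𝒳 → 𝒴 → ℝ | IsChannel Q},
        condKL P Q (W s) + ENNReal.ofReal (mutualInfo P Q - R))
    rw [rhoSucc, ← hs]
    exact iInf_condKL_add_pos hP.1 (hW s) (hR.trans_le (ciInf_le (Set.finite_range _).bddBelow s))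

end JCAS
end
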